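/- Let Γ be a metric-compatible connection on the trivial bundle ℝⁿ × ℝᵐ with polynomial curvature growth to order two, and fix x₀ ∈ ℝⁿ and t₀ > 0. Then the following are equivalent: (i) (Γ, x₀, t₀) is a critical point of the ℱ-functional, i.e. for every smooth compactly supported skew-symmetric-matrix-valued B, every v ∈ ℝⁿ and every τ ∈ ℝ, the function s ↦ ℱ_{x₀+sv, t₀+sτ}(Γ + sB) is differentiable at s = 0 with derivative 0; (ii) Γ is an (x₀,t₀)-soliton. -/

import Mathlib

open MeasureTheory Real Filter Matrix
open scoped ENNReal

noncomputable section

namespace YM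

variable {n m : ℕ}

/-- A connection on the trivial bundle `ℝⁿ × ℝᵐ`, given by its coefficient
matrices `Γ₁(x), …, Γₙ(x)`. -/
abbrev Conn (n m : ℕ) :=
  (Fin n → ℝ) → Fin n → Matrix (Fin m) (Fin m) ℝ

/-- Entrywise `i`-th partial derivative of a matrix-valued map on `ℝⁿ`. -/
def pder (i : Fin n) (A : (Fin n → ℝ) → Matrix (Fin m) (Fin m) ℝ)
    (x : Fin n → ℝ) : Matrix (Fin m) (Fin m) ℝ :=
  Matrix.of fun a b => fderiv ℝ (fun y => A y a b) x (Pi.single i 1)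

/-- Smoothness (entrywise) of a matrix-valued map on `ℝⁿ`. -/
def SmoothMat (A : (Fin n → ℝ) → Matrix (Fin m) (Fin m) ℝ) : Prop :=
  ∀ a b, ContDiff ℝ (⊤ : ℕ∞) fun y => A y a b

/-- Smoothness of a connection. -/
def Smooth (Γ : Conn n m) : Prop :=
  ∀ i, SmoothMat fun x => Γ x i

/-- Matrix commutator. -/
def comm (A B : Matrix (Fin m) (Fin m) ℝ) : Matrix (Fin m) (Fin m) ℝ :=
  A * B - B * A

/-- Curvature `F_{ij} = ∂ᵢΓⱼ − ∂ⱼΓᵢ + [Γᵢ, Γⱼ]`. -/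
def curv (Γ : Conn n m) (i j : Fin n) (x : Fin n → ℝ) :
    Matrix (Fin m) (Fin m) ℝ :=
  pder i (fun y => Γ y j) x - pder j (fun y => Γ y i) x + comm (Γ x i) (Γ x j)

/-- Covariant derivative `∇ᵢA = ∂ᵢA + [Γᵢ, A]`. -/
def covDer (Γ : Conn n m) (i : Fin n)
    (A : (Fin n → ℝ) → Matrix (Fin m) (Fin m) ℝ) (x : Fin n → ℝ) :
    Matrix (Fin m) (Fin m) ℝ :=
  pder i A x + comm (Γ x i) (A x)

/-- `(D*F)ₖ = −Σᵢ ∇ᵢF_{ik}`. -/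
def dstarF (Γ : Conn n m) (k : Fin n) (x : Fin n → ℝ) :
    Matrix (Fin m) (Fin m) ℝ :=
  - ∑ i, covDer Γ i (fun y => curv Γ i k y) x

/-- Squared Frobenius norm of a matrix. -/
def frobSq (A : Matrix (Fin m) (Fin m) ℝ) : ℝ := ∑ a, ∑ b, (A a b) ^ 2

/-- Frobenius norm of a matrix. -/
def frobNorm (A : Matrix (Fin m) (Fin m) ℝ) : ℝ := Real.sqrt (frobSq A)

/-- Frobenius inner product `⟨A, B⟩ = tr(A Bᵀ)`. -/
def frobInner (A B : Matrix (Fin m) (Fin m) ℝ) : ℝ := ∑ a, ∑ b, A a b * B a b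

/-- `|F(x)|² = Σ_{i,j} ‖F_{ij}(x)‖²` (Frobenius norms). -/
def normSqF (Γ : Conn n m) (x : Fin n → ℝ) : ℝ :=
  ∑ i, ∑ j, frobSq (curv Γ i j x)

/-- `|F(x)|`. -/
def normF (Γ : Conn n m) (x : Fin n → ℝ) : ℝ := Real.sqrt (normSqF Γ x)

/-- Euclidean norm on `ℝⁿ`. -/
def enorm (x : Fin n → ℝ) : ℝ := Real.sqrt (∑ i, x i ^ 2)

/-- Metric compatibility: all coefficient matrices are skew-symmetric. -/
def MetricCompat (Γ : Conn n m) : Prop :=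
  ∀ x i, (Γ x i)ᵀ = -(Γ x i)

/-- `(x₀,t₀)`-soliton: `Σᵢ ∇ᵢF_{ik} = (1/(2t₀)) Σᵢ (x−x₀)ᵢ F_{ik}`. -/
def IsSolitonAt (Γ : Conn n m) (x₀ : Fin n → ℝ) (t₀ : ℝ) : Prop :=
  ∀ (x : Fin n → ℝ) (k : Fin n),
    ∑ i, covDer Γ i (fun y => curv Γ i k y) x
      = (1 / (2 * t₀)) • ∑ i, (x i - x₀ i) • curv Γ i k x

/-- `(0,1)`-soliton. -/
def IsSoliton (Γ : Conn n m) : Prop := IsSolitonAt Γ 0 1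

/-- The `ℱ`-functional
`ℱ_{x₀,t₀}(Γ) = t₀² (4πt₀)^{−n/2} ∫ |F|² e^{−|x−x₀|²/(4t₀)}`. -/
def Ffunc (Γ : Conn n m) (x₀ : Fin n → ℝ) (t₀ : ℝ) : ℝ :=
  t₀ ^ 2 * (4 * π * t₀) ^ (-(n : ℝ) / 2) *
    ∫ x : Fin n → ℝ,
      normSqF Γ x * Real.exp (-(∑ i, (x i - x₀ i) ^ 2) / (4 * t₀))

/-- The entropy `λ(Γ) = sup_{x₀, t₀>0} ℱ_{x₀,t₀}(Γ)`, valued in `[0,∞]`. -/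
def entropy (Γ : Conn n m) : ℝ≥0∞ :=
  ⨆ (x₀ : Fin n → ℝ) (t₀ : ℝ) (_ : 0 < t₀), ENNReal.ofReal (Ffunc Γ x₀ t₀)

/-- Polynomial curvature growth: `|F(x)| ≤ p(|x|)`. -/
def PolyCurvGrowth (Γ : Conn n m) : Prop :=
  ∃ p : Polynomial ℝ, ∀ x, normF Γ x ≤ p.eval (enorm x)

/-- Polynomial curvature growth to order two. -/
def PolyCurvGrowth2 (Γ : Conn n m) : Prop :=
  ∃ p : Polynomial ℝ, ∀ x,
    normF Γ x
      + (∑ i, ∑ j, ∑ k, frobNorm (covDer Γ i (fun y => curv Γ j k y) x))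
      + (∑ i, ∑ j, ∑ k, ∑ l,
          frobNorm (covDer Γ i
            (fun y => covDer Γ j (fun z => curv Γ k l z) y) x))
      ≤ p.eval (enorm x)

/-- Cylindrical: some nonzero constant vector `V` satisfies `V ⌟ F ≡ 0`. -/
def Cylindrical (Γ : Conn n m) : Prop :=
  ∃ V : Fin n → ℝ, V ≠ 0 ∧
    ∀ (x : Fin n → ℝ) (k : Fin n), ∑ i, V i • curv Γ i k x = 0

/-- `(DB)_{ij} = ∇ᵢBⱼ − ∇ⱼBᵢ`. -/
def Dop (Γ B : Conn n m) (i j : Fin n) (x : Fin n → ℝ) :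
    Matrix (Fin m) (Fin m) ℝ :=
  covDer Γ i (fun y => B y j) x - covDer Γ j (fun y => B y i) x

/-- The second variation operator
`(L_{x₀,t₀}B)ₖ = −Σᵢ∇ᵢ(DB)_{ik} + (1/(2t₀))Σᵢ(x−x₀)ᵢ(DB)_{ik} + Σᵢ[Bᵢ,F_{ik}]`. -/
def Lop (Γ B : Conn n m) (x₀ : Fin n → ℝ) (t₀ : ℝ) (k : Fin n)
    (x : Fin n → ℝ) : Matrix (Fin m) (Fin m) ℝ :=
  (- ∑ i, covDer Γ i (fun y => Dop Γ B i k y) x)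
    + (1 / (2 * t₀)) • ∑ i, (x i - x₀ i) • Dop Γ B i k x
    + ∑ i, comm (B x i) (curv Γ i k x)

/-- The Gaussian weight `G(x) = (4π)^{−n/2} e^{−|x|²/4}`. -/
def gaussG (n : ℕ) (x : Fin n → ℝ) : ℝ :=
  (4 * π) ^ (-(n : ℝ) / 2) * Real.exp (-(∑ i, x i ^ 2) / 4)

/-- The second variation form `Q(σ,V,B)` of a `(0,1)`-soliton. -/
def Q (Γ : Conn n m) (σ : ℝ) (V : Fin n → ℝ) (B : Conn n m) : ℝ :=
  -4 * σ ^ 2 * (∫ x : Fin n → ℝ, (∑ k, frobSq (dstarF Γ k x)) * gaussG n x)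
    - 2 * (∫ x : Fin n → ℝ,
        (∑ k, frobSq (∑ i, V i • curv Γ i k x)) * gaussG n x)
    + 4 * (∫ x : Fin n → ℝ,
        (∑ k, frobInner (B x k) (Lop Γ B 0 1 k x)) * gaussG n x)
    - 4 * (∫ x : Fin n → ℝ,
        (∑ k, frobInner (B x k)
          (∑ i, (σ * x i + V i) • curv Γ i k x)) * gaussG n x)

/-- Skew-symmetric-matrix-valued 1-form. -/
def SkewVals (B : Conn n m) : Prop := ∀ x i, (B x i)ᵀ = -(B x i)

/-- `ℱ`-instability. -/
def FUnstable (Γ : Conn n m) : Prop :=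
  ∃ B : Conn n m, Smooth B ∧ HasCompactSupport B ∧ SkewVals B ∧
    ∀ (σ : ℝ) (V : Fin n → ℝ), Q Γ σ V B < 0

/-- Joint smoothness (entrywise) of a one-parameter family of connections on a
time set `S`. -/
def SmoothFamilyOn (Γt : ℝ → Conn n m) (S : Set ℝ) : Prop :=
  ∀ (k : Fin n) (a b : Fin m),
    ContDiffOn ℝ (⊤ : ℕ∞) (fun p : ℝ × (Fin n → ℝ) => Γt p.1 p.2 k a b)
      (S ×ˢ (Set.univ : Set (Fin n → ℝ)))

/-- Yang–Mills flow: `∂ₜ(Γ_t)ₖ = Σᵢ ∇ᵢ(F_t)_{ik}` on a time set `S`. -/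
def YMFlowOn (Γt : ℝ → Conn n m) (S : Set ℝ) : Prop :=
  ∀ t ∈ S, ∀ (x : Fin n → ℝ) (k : Fin n) (a b : Fin m),
    HasDerivWithinAt (fun t' => Γt t' x k a b)
      ((∑ i, covDer (Γt t) i (fun y => curv (Γt t) i k y) x) a b) S t

/-- Locally uniform in time polynomial curvature growth to order two. -/
def PolyCurvGrowth2On (Γt : ℝ → Conn n m) (S : Set ℝ) : Prop :=
  ∀ J : Set ℝ, IsCompact J → J ⊆ S →
    ∃ p : Polynomial ℝ, ∀ t ∈ J, ∀ x,
      normF (Γt t) x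
        + (∑ i, ∑ j, ∑ k,
            frobNorm (covDer (Γt t) i (fun y => curv (Γt t) j k y) x))
        + (∑ i, ∑ j, ∑ k, ∑ l,
            frobNorm (covDer (Γt t) i
              (fun y => covDer (Γt t) j (fun z => curv (Γt t) k l z) y) x))
        ≤ p.eval (enorm x)

end YM
namespace YM

variable {n m : ℕ}

/-- Squared Euclidean length. -/
def sq (x : Fin n → ℝ) : ℝ := ∑ i, x i ^ 2

lemma sq_nonneg' (x : Fin n → ℝ) : 0 ≤ sq x := Finset.sum_nonneg fun i _ => sq_nonneg _

/-- Sub-Gaussian growth. -/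
def Gr (f : (Fin n → ℝ) → ℝ) : Prop :=
  ∀ b > 0, ∃ C, 0 ≤ C ∧ ∀ x, |f x| ≤ C * exp (b * sq x)

lemma Gr.mono {f g : (Fin n → ℝ) → ℝ} (hg : Gr g) (h : ∀ x, |f x| ≤ g x) : Gr f := by
  intro b hb
  obtain ⟨C, hC, hx⟩ := hg b hb
  exact ⟨C, hC, fun x => (h x).trans ((le_abs_self _).trans (hx x))⟩

lemma Gr.const (c : ℝ) : Gr (fun _ : Fin n → ℝ => c) := by
  intro b hb
  refine ⟨|c|, abs_nonneg _, fun x => ?_⟩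
  have : 1 ≤ exp (b * sq x) := one_le_exp (mul_nonneg hb.le (sq_nonneg' x))
  nlinarith [abs_nonneg c]

lemma Gr.add {f g : (Fin n → ℝ) → ℝ} (hf : Gr f) (hg : Gr g) : Gr (fun x => f x + g x) := by
  intro b hb
  obtain ⟨C, hC, hx⟩ := hf b hb
  obtain ⟨D, hD, hy⟩ := hg b hb
  refine ⟨C + D, by positivity, fun x => (abs_add_le _ _).trans ?_⟩
  have := hx x
  have := hy x
  linarith

lemma Gr.mul {f g : (Fin n → ℝ) → ℝ} (hf : Gr f) (hg : Gr g) : Gr (fun x => f x * g x) := by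
  intro b hb
  obtain ⟨C, hC, hx⟩ := hf (b / 2) (by positivity)
  obtain ⟨D, hD, hy⟩ := hg (b / 2) (by positivity)
  refine ⟨C * D, by positivity, fun x => ?_⟩
  have e : exp (b * sq x) = exp (b / 2 * sq x) * exp (b / 2 * sq x) := by
    rw [← exp_add]; ring_nf
  rw [abs_mul, e]
  calc |f x| * |g x| ≤ (C * exp (b / 2 * sq x)) * (D * exp (b / 2 * sq x)) :=
        mul_le_mul (hx x) (hy x) (abs_nonneg _) (by positivity)
    _ = _ := by ring

lemma Gr.neg {f : (Fin n → ℝ) → ℝ} (hf : Gr f) : Gr (fun x => - f x) := by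
  intro b hb
  obtain ⟨C, hC, hx⟩ := hf b hb
  exact ⟨C, hC, fun x => by rw [abs_neg]; exact hx x⟩

lemma Gr.sub {f g : (Fin n → ℝ) → ℝ} (hf : Gr f) (hg : Gr g) : Gr (fun x => f x - g x) := by
  simpa [sub_eq_add_neg] using hf.add hg.neg

lemma Gr.abs {f : (Fin n → ℝ) → ℝ} (hf : Gr f) : Gr (fun x => |f x|) := by
  intro b hb
  obtain ⟨C, hC, hx⟩ := hf b hb
  exact ⟨C, hC, fun x => by rw [abs_abs]; exact hx x⟩

lemma Gr.sum {ι : Type*} (s : Finset ι) {f : ι → (Fin n → ℝ) → ℝ} (hf : ∀ i, Gr (f i)) :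
    Gr (fun x => ∑ i ∈ s, f i x) := by
  classical
  induction s using Finset.induction_on with
  | empty => simpa using Gr.const 0
  | insert a s ha ih => simpa [Finset.sum_insert ha] using (hf a).add ih

lemma Gr.pow {f : (Fin n → ℝ) → ℝ} (hf : Gr f) (k : ℕ) : Gr (fun x => f x ^ k) := by
  induction k with
  | zero => simpa using Gr.const 1
  | succ k ih => simpa [pow_succ] using ih.mul hf

lemma Gr.enorm : Gr (fun x : Fin n → ℝ => enorm x) := by
  intro b hb
  refine ⟨1 + 1 / b, by positivity, fun x => ?_⟩
  have h0 : 0 ≤ YM.enorm x := Real.sqrt_nonneg _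
  have h1 : YM.enorm x ^ 2 = sq x := Real.sq_sqrt (sq_nonneg' x)
  rw [abs_of_nonneg h0]
  have h2 : b * sq x + 1 ≤ exp (b * sq x) := add_one_le_exp _
  have h3 : YM.enorm x ≤ 1 + sq x := by nlinarith
  have h4 : (1 + 1 / b) * (b * sq x + 1) = b * sq x + 1 + sq x + 1 / b := by
    field_simp; ring
  have h5 : (1 + 1 / b) * (b * sq x + 1) ≤ (1 + 1 / b) * exp (b * sq x) := by gcongr
  have h6 : 0 ≤ b * sq x := mul_nonneg hb.le (sq_nonneg' x)
  have h7 : 0 ≤ 1 / b := by positivity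
  linarith

lemma Gr.poly (p : Polynomial ℝ) : Gr (fun x : Fin n → ℝ => p.eval (YM.enorm x)) := by
  induction p using Polynomial.induction_on' with
  | add p q hp hq => simpa using hp.add hq
  | monomial k a => simpa using (Gr.const a).mul (Gr.enorm.pow k)

lemma abs_le_enorm (x : Fin n → ℝ) (i : Fin n) : |x i| ≤ YM.enorm x := by
  apply Real.abs_le_sqrt
  exact Finset.single_le_sum (f := fun i => x i ^ 2) (fun i _ => sq_nonneg _) (Finset.mem_univ i)

lemma Gr.coord (i : Fin n) : Gr (fun x : Fin n → ℝ => x i) :=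
  Gr.enorm.mono fun x => abs_le_enorm x i

lemma Gr.of_compact {f : (Fin n → ℝ) → ℝ} (hc : Continuous f) (hs : HasCompactSupport f) :
    Gr f := by
  obtain ⟨C, hC⟩ := hs.exists_bound_of_continuous hc
  exact (Gr.const C).mono fun x => hC x

lemma integrable_gauss {b : ℝ} (hb : 0 < b) :
    Integrable (fun x : Fin n → ℝ => exp (-b * sq x)) := by
  have := Integrable.fintype_prod (ι := Fin n) (f := fun _ (v : ℝ) => exp (-b * v ^ 2))
    (μ := fun _ => volume) (fun _ => integrable_exp_neg_mul_sq hb)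
  refine this.congr (ae_of_all _ fun x => ?_)
  simp only [sq, Finset.mul_sum, exp_sum]

lemma Gr.integrable {f g : (Fin n → ℝ) → ℝ} (hf : Gr f) (hc : Continuous f) (hg : Continuous g)
    {b K : ℝ} (hb : 0 < b) (hgb : ∀ x, |g x| ≤ K * exp (-b * sq x)) :
    Integrable (fun x => f x * g x) := by
  obtain ⟨C, hC, hx⟩ := hf (b / 2) (by positivity)
  refine ((integrable_gauss (n := n) (b := b / 2) (by positivity)).const_mul (C * K)).mono'
    (hc.mul hg).aestronglyMeasurable (ae_of_all _ fun x => ?_)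
  rw [norm_mul, norm_eq_abs, norm_eq_abs]
  calc |f x| * |g x| ≤ (C * exp (b / 2 * sq x)) * (K * exp (-b * sq x)) :=
        mul_le_mul (hx x) (hgb x) (abs_nonneg _) (by positivity)
    _ = C * K * (exp (b / 2 * sq x) * exp (-b * sq x)) := by ring
    _ = _ := by rw [← exp_add]; ring_nf

/-- Gaussian weight. -/
def gw (x₀ : Fin n → ℝ) (t : ℝ) (x : Fin n → ℝ) : ℝ :=
  exp (-(∑ i, (x i - x₀ i) ^ 2) / (4 * t))

lemma gw_pos (x₀ : Fin n → ℝ) (t : ℝ) (x : Fin n → ℝ) : 0 < gw x₀ t x := exp_pos _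

lemma gw_contDiff (x₀ : Fin n → ℝ) (t : ℝ) : ContDiff ℝ (⊤ : ℕ∞) (gw x₀ t) := by
  unfold gw; fun_prop

lemma gw_le (x₀ : Fin n → ℝ) (r : Fin n → ℝ) (hr : ∀ i, |x₀ i| ≤ r i) (t T : ℝ) (ht : 0 < t)
    (htT : t ≤ T) (x : Fin n → ℝ) :
    gw x₀ t x ≤ exp (sq r / (4 * T)) * exp (-(1 / (8 * T)) * sq x) := by
  have hT : 0 < T := ht.trans_le htT
  rw [gw, ← exp_add]
  apply exp_le_exp.2
  set S := ∑ i, (x i - x₀ i) ^ 2 with hS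
  have hS0 : 0 ≤ S := Finset.sum_nonneg fun i _ => sq_nonneg _
  have h1 : -S / (4 * t) ≤ -S / (4 * T) := by
    rw [neg_div, neg_div]
    apply neg_le_neg
    gcongr
  have h2 : sq x / 2 - sq r ≤ S := by
    rw [hS, sq, sq, Finset.sum_div, ← Finset.sum_sub_distrib]
    apply Finset.sum_le_sum
    intro i _
    have : x₀ i ^ 2 ≤ r i ^ 2 := sq_le_sq' (by linarith [neg_abs_le (x₀ i), hr i])
      ((le_abs_self _).trans (hr i))
    nlinarith [sq_nonneg (x i - 2 * x₀ i)]
  calc -S / (4 * t) ≤ -S / (4 * T) := h1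
    _ ≤ (sq r - sq x / 2) / (4 * T) := by gcongr; linarith
    _ = _ := by field_simp; ring

lemma Gr.integrable_gw {f : (Fin n → ℝ) → ℝ} (hf : Gr f) (hc : Continuous f)
    (x₀ : Fin n → ℝ) {t : ℝ} (ht : 0 < t) :
    Integrable (fun x => f x * gw x₀ t x) := by
  refine hf.integrable hc (gw_contDiff x₀ t).continuous (b := 1 / (8 * t))
    (K := exp (sq (fun i => |x₀ i|) / (4 * t))) (by positivity) fun x => ?_
  rw [abs_of_pos (gw_pos _ _ _)]
  exact gw_le x₀ _ (fun i => le_rfl) t t ht le_rfl x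

/-- Derivative of the exponent at `s`. -/
def gwE (x₀ v : Fin n → ℝ) (t τ : ℝ) (x : Fin n → ℝ) : ℝ :=
  (∑ i, (x i - x₀ i) * v i) / (2 * t) + τ * (∑ i, (x i - x₀ i) ^ 2) / (4 * t ^ 2)

lemma gw_hasDerivAt (x₀ v : Fin n → ℝ) (t τ s : ℝ) (x : Fin n → ℝ) (h : t + s * τ ≠ 0) :
    HasDerivAt (fun s : ℝ => gw (x₀ + s • v) (t + s * τ) x)
      (gwE (x₀ + s • v) v (t + s * τ) τ x * gw (x₀ + s • v) (t + s * τ) x) s := by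
  have h1 : ∀ i, HasDerivAt (fun s : ℝ => (x i - (x₀ + s • v) i) ^ 2)
      (2 * (x i - (x₀ + s • v) i) * (- v i)) s := by
    intro i
    have : HasDerivAt (fun s : ℝ => x i - (x₀ + s • v) i) (- v i) s := by
      simp only [Pi.add_apply, Pi.smul_apply, smul_eq_mul]
      have := (((hasDerivAt_id s).mul_const (v i)).const_add (x₀ i)).const_sub (x i)
      simpa using this
    simpa using this.fun_pow 2
  have h2 := HasDerivAt.fun_sum (u := Finset.univ) fun i _ => h1 i
  have h3 : HasDerivAt (fun s : ℝ => 4 * (t + s * τ)) (4 * τ) s := by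
    have := (((hasDerivAt_id s).mul_const τ).const_add t).const_mul 4
    simpa using this
  have h4 := ((h2.fun_neg.fun_div h3 (by simpa using h))).exp
  unfold gw
  convert h4 using 1
  rw [mul_comm]
  congr 1
  unfold gwE
  have e : ∑ i, 2 * (x i - (x₀ + s • v) i) * (- v i)
    = -2 * ∑ i, (x i - (x₀ + s • v) i) * v i := by
    rw [Finset.mul_sum]; exact Finset.sum_congr rfl fun i _ => by ring
  rw [e]
  field_simp
  ring

lemma integral_hasDerivAt {f : (Fin n → ℝ) → ℝ} (hf : Gr f) (hc : Continuous f)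
    (x₀ v : Fin n → ℝ) {t : ℝ} (ht : 0 < t) (τ : ℝ) :
    HasDerivAt (fun s : ℝ => ∫ x, f x * gw (x₀ + s • v) (t + s * τ) x)
      (∫ x, f x * (gwE x₀ v t τ x * gw x₀ t x)) 0 := by
  obtain ⟨ε, hε, hε1, hετ⟩ : ∃ ε : ℝ, 0 < ε ∧ ε ≤ 1 ∧ ε * |τ| ≤ t / 2 := by
    refine ⟨min 1 (t / (2 * (|τ| + 1))), by positivity, min_le_left _ _, ?_⟩
    calc min 1 (t / (2 * (|τ| + 1))) * |τ| ≤ t / (2 * (|τ| + 1)) * (|τ| + 1) := by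
          gcongr
          · exact min_le_right _ _
          · linarith
      _ = t / 2 := by field_simp
  have hs : ∀ s ∈ Metric.ball (0 : ℝ) ε, t / 2 ≤ t + s * τ ∧ t + s * τ ≤ 2 * t ∧ |s| ≤ 1 := by
    intro s hs
    rw [Metric.mem_ball, dist_zero_right, norm_eq_abs] at hs
    have h1 : |s * τ| ≤ t / 2 := by
      rw [abs_mul]
      exact (mul_le_mul_of_nonneg_right hs.le (abs_nonneg _)).trans hετ
    have := abs_le.1 h1
    refine ⟨by linarith, by linarith, by linarith⟩
  set r : Fin n → ℝ := fun i => |x₀ i| + |v i| with hr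
  have hrb : ∀ s : ℝ, |s| ≤ 1 → ∀ i, |(x₀ + s • v) i| ≤ r i := by
    intro s h1 i
    simp only [Pi.add_apply, Pi.smul_apply, smul_eq_mul, hr]
    refine (abs_add_le _ _).trans ?_
    rw [abs_mul]
    nlinarith [abs_nonneg (v i)]
  set h : (Fin n → ℝ) → ℝ := fun x =>
    (∑ i, (|x i| + r i) * |v i|) / t + |τ| * (∑ i, (|x i| + r i) ^ 2) / t ^ 2 with hh
  have hhG : Gr h := by
    have hx : ∀ i, Gr (fun x : Fin n → ℝ => |x i| + r i) := fun i =>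
      (Gr.coord i).abs.add (Gr.const _)
    have h1 : Gr (fun x : Fin n → ℝ => (∑ i, (|x i| + r i) * |v i|) * t⁻¹) :=
      (Gr.sum _ fun i => (hx i).mul (Gr.const _)).mul (Gr.const _)
    have h2 : Gr (fun x : Fin n → ℝ => (|τ| * (∑ i, (|x i| + r i) ^ 2)) * (t ^ 2)⁻¹) :=
      ((Gr.const _).mul (Gr.sum _ fun i => (hx i).pow 2)).mul (Gr.const _)
    simpa [hh, div_eq_mul_inv] using h1.add h2
  have hhc : Continuous h := by
    rw [hh]; fun_prop
  have key := hasDerivAt_integral_of_dominated_loc_of_deriv_le (μ := (volume : Measure (Fin n → ℝ)))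
    (F := fun s x => f x * gw (x₀ + s • v) (t + s * τ) x)
    (F' := fun s x => f x * (gwE (x₀ + s • v) v (t + s * τ) τ x * gw (x₀ + s • v) (t + s * τ) x))
    (bound := fun x => (|f x| * h x) *
      (exp (sq r / (4 * (2 * t))) * exp (-(1 / (8 * (2 * t))) * sq x)))
    (Metric.ball_mem_nhds (0 : ℝ) hε) ?_ ?_ ?_ ?_ ?_ ?_
  · simpa using key.2
  · exact Eventually.of_forall fun s =>
      (hc.mul (gw_contDiff _ _).continuous).aestronglyMeasurable
  · simpa using hf.integrable_gw hc x₀ ht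
  · refine (hc.mul (Continuous.mul ?_ (gw_contDiff _ _).continuous)).aestronglyMeasurable
    unfold gwE
    fun_prop
  · refine ae_of_all _ fun x s hsb => ?_
    obtain ⟨h1, h2, h3⟩ := hs s hsb
    have hpos : 0 < t + s * τ := by linarith
    rw [norm_mul, norm_mul, norm_eq_abs, norm_eq_abs, norm_eq_abs, abs_of_pos (gw_pos _ _ _),
      ← mul_assoc]
    have hg := gw_le (x₀ + s • v) r (hrb s h3) (t + s * τ) (2 * t) hpos h2 x
    have hxi : ∀ i, |x i - (x₀ + s • v) i| ≤ |x i| + r i := fun i =>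
      (abs_sub _ _).trans (by linarith [hrb s h3 i])
    have hE : |gwE (x₀ + s • v) v (t + s * τ) τ x| ≤ h x := by
      unfold gwE
      refine (abs_add_le _ _).trans (add_le_add ?_ ?_)
      · rw [abs_div, abs_of_pos (by positivity : 0 < 2 * (t + s * τ))]
        apply div_le_div₀ _ _ ht (by linarith)
        · exact Finset.sum_nonneg fun i _ => by positivity
        · refine (Finset.abs_sum_le_sum_abs _ _).trans (Finset.sum_le_sum fun i _ => ?_)
          rw [abs_mul]
          exact mul_le_mul_of_nonneg_right (hxi i) (abs_nonneg _)
      · rw [abs_div, abs_mul, abs_of_pos (by positivity : 0 < 4 * (t + s * τ) ^ 2)]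
        apply div_le_div₀ _ _ (by positivity) (by nlinarith)
        · exact mul_nonneg (abs_nonneg _) (Finset.sum_nonneg fun i _ => by positivity)
        · refine mul_le_mul_of_nonneg_left ?_ (abs_nonneg _)
          refine (Finset.abs_sum_le_sum_abs _ _).trans (Finset.sum_le_sum fun i _ => ?_)
          rw [abs_pow]
          exact pow_le_pow_left₀ (abs_nonneg _) (hxi i) 2
    exact mul_le_mul (mul_le_mul_of_nonneg_left hE (abs_nonneg _)) hg (gw_pos _ _ _).le
      (mul_nonneg (abs_nonneg _) ((abs_nonneg _).trans hE))
  · refine (hf.abs.mul hhG).integrable (hc.abs.mul hhc) (b := 1 / (8 * (2 * t)))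
      (K := exp (sq r / (4 * (2 * t)))) ?_ (by positivity) fun x => ?_
    · unfold sq; fun_prop
    · rw [abs_of_pos (by positivity)]
  · refine ae_of_all _ fun x s hsb => ?_
    obtain ⟨h1, h2, h3⟩ := hs s hsb
    exact (gw_hasDerivAt x₀ v t τ s x (by linarith)).const_mul (f x)

/-- Partial derivative of a scalar function. -/
def pd (i : Fin n) (f : (Fin n → ℝ) → ℝ) (x : Fin n → ℝ) : ℝ := fderiv ℝ f x (Pi.single i 1)

lemma gw_pd (x₀ : Fin n → ℝ) (t : ℝ) (i : Fin n) (x : Fin n → ℝ) :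
    pd i (gw x₀ t) x = -((x i - x₀ i) / (2 * t)) * gw x₀ t x := by
  have h1 : ∀ j, HasFDerivAt (fun x : Fin n → ℝ => (x j - x₀ j) ^ 2)
      ((2 * (x j - x₀ j)) • ContinuousLinearMap.proj (R := ℝ) (φ := fun _ : Fin n => ℝ) j) x := by
    intro j
    have := ((ContinuousLinearMap.proj (R := ℝ) (φ := fun _ : Fin n => ℝ) j).hasFDerivAt
      (x := x)).sub_const (x₀ j)
    simpa using this.pow 2
  have h2 := HasFDerivAt.fun_sum (u := Finset.univ) fun j _ => h1 j
  have h3 := (h2.fun_neg.mul_const ((4 * t)⁻¹)).exp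
  have h4 : gw x₀ t = fun x => exp (-(∑ j, (x j - x₀ j) ^ 2) * (4 * t)⁻¹) := by
    funext x
    simp only [gw, div_eq_mul_inv]
  rw [pd, h4, h3.fderiv]
  simp [Pi.single_apply, div_eq_mul_inv]
  ring

lemma integral_pd_eq_zero {f : (Fin n → ℝ) → ℝ} (hd : Differentiable ℝ f) (hf : Integrable f)
    (i : Fin n) (hf' : Integrable (pd i f)) : ∫ x, pd i f x = 0 := by
  have := integral_mul_fderiv_eq_neg_fderiv_mul_of_integrable
    (μ := (volume : Measure (Fin n → ℝ))) (𝕜 := ℝ) (f := fun _ => (1 : ℝ)) (g := f)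
    (v := Pi.single i 1) (by simp) (by simpa using (show Integrable (fun x => fderiv ℝ f x (Pi.single i 1)) volume from hf')) (by simpa using hf)
    (fun x _ => by fun_prop) (fun x _ => hd x)
  simpa [pd] using this

lemma div_zero' (P : Fin n → (Fin n → ℝ) → ℝ) (hP : ∀ i, ContDiff ℝ (⊤ : ℕ∞) (P i))
    (hG : ∀ i, Gr (P i)) (hG' : ∀ i, Gr (pd i (P i))) (x₀ : Fin n → ℝ) {t : ℝ} (ht : 0 < t) :
    ∫ x, (∑ i, (pd i (P i) x - (x i - x₀ i) / (2 * t) * P i x)) * gw x₀ t x = 0 := by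
  have hne : ((⊤ : ℕ∞) : WithTop ℕ∞) ≠ 0 := by simp
  have hpc : ∀ i, Continuous (pd i (P i)) := fun i =>
    ((hP i).continuous_fderiv hne).clm_apply continuous_const
  have hpd : ∀ i, pd i (fun x => P i x * gw x₀ t x) =
      fun x => (pd i (P i) x - (x i - x₀ i) / (2 * t) * P i x) * gw x₀ t x := by
    intro i
    funext x
    have h1 := ((hP i).differentiable hne x).hasFDerivAt
    have h2 := ((gw_contDiff x₀ t).differentiable hne x).hasFDerivAt
    have h3 := gw_pd x₀ t i x
    rw [pd] at h3
    rw [pd, (h1.fun_mul h2).fderiv]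
    simp only [_root_.add_apply, _root_.smul_apply, smul_eq_mul, h3, pd]
    ring
  have hIntegr : ∀ i, Integrable fun x =>
      (pd i (P i) x - (x i - x₀ i) / (2 * t) * P i x) * gw x₀ t x := by
    intro i
    refine Gr.integrable_gw ?_ ?_ x₀ ht
    · refine (hG' i).sub (Gr.mul ?_ (hG i))
      simpa [div_eq_mul_inv] using ((Gr.coord i).sub (Gr.const (x₀ i))).mul (Gr.const (2 * t)⁻¹)
    · have := hpc i
      have := (hP i).continuous
      fun_prop
  simp only [Finset.sum_mul]
  rw [integral_finsetSum _ fun i _ => hIntegr i]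
  refine Finset.sum_eq_zero fun i _ => ?_
  have := integral_pd_eq_zero (f := fun x => P i x * gw x₀ t x)
    (((hP i).mul (gw_contDiff x₀ t)).differentiable hne)
    ((hG i).integrable_gw (hP i).continuous x₀ ht) i (by rw [hpd i]; exact hIntegr i)
  rw [hpd i] at this
  exact this

end YM
namespace YM

variable {n m : ℕ}

lemma top_ne : ((⊤ : ℕ∞) : WithTop ℕ∞) ≠ 0 := by simp

lemma pder_apply (i : Fin n) (A : (Fin n → ℝ) → Matrix (Fin m) (Fin m) ℝ) (x : Fin n → ℝ)
    (a b : Fin m) : pder i A x a b = pd i (fun y => A y a b) x := rfl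

lemma pd_add {f g : (Fin n → ℝ) → ℝ} (hf : ContDiff ℝ (⊤ : ℕ∞) f) (hg : ContDiff ℝ (⊤ : ℕ∞) g)
    (i : Fin n) (x) : pd i (fun y => f y + g y) x = pd i f x + pd i g x := by
  unfold pd
  rw [fderiv_fun_add (hf.differentiable top_ne x) (hg.differentiable top_ne x)]
  rfl

lemma pd_sub {f g : (Fin n → ℝ) → ℝ} (hf : ContDiff ℝ (⊤ : ℕ∞) f) (hg : ContDiff ℝ (⊤ : ℕ∞) g)
    (i : Fin n) (x) : pd i (fun y => f y - g y) x = pd i f x - pd i g x := by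
  unfold pd
  rw [fderiv_fun_sub (hf.differentiable top_ne x) (hg.differentiable top_ne x)]
  rfl

lemma pd_mul {f g : (Fin n → ℝ) → ℝ} (hf : ContDiff ℝ (⊤ : ℕ∞) f) (hg : ContDiff ℝ (⊤ : ℕ∞) g)
    (i : Fin n) (x) : pd i (fun y => f y * g y) x = pd i f x * g x + f x * pd i g x := by
  unfold pd
  rw [fderiv_fun_mul (hf.differentiable top_ne x) (hg.differentiable top_ne x)]
  simp only [_root_.add_apply, _root_.smul_apply, smul_eq_mul]
  ring

lemma pd_const (c : ℝ) (i : Fin n) (x) : pd i (fun _ => c) x = 0 := by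
  simp [pd]

lemma pd_sum {ι : Type*} (s : Finset ι) {f : ι → (Fin n → ℝ) → ℝ}
    (hf : ∀ k, ContDiff ℝ (⊤ : ℕ∞) (f k)) (i : Fin n) (x) :
    pd i (fun y => ∑ k ∈ s, f k y) x = ∑ k ∈ s, pd i (f k) x := by
  unfold pd
  rw [fderiv_fun_sum fun k _ => (hf k).differentiable top_ne x]
  simp

lemma pd_coord (j i : Fin n) (x) : pd i (fun y : Fin n → ℝ => y j) x = if j = i then 1 else 0 := by
  unfold pd
  have : HasFDerivAt (fun y : Fin n → ℝ => y j)
    (ContinuousLinearMap.proj (R := ℝ) (φ := fun _ : Fin n => ℝ) j) x :=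
    (ContinuousLinearMap.proj (R := ℝ) (φ := fun _ : Fin n => ℝ) j).hasFDerivAt
  rw [this.fderiv]
  simp [Pi.single_apply]

lemma pd_contDiff {f : (Fin n → ℝ) → ℝ} (hf : ContDiff ℝ (⊤ : ℕ∞) f) (i : Fin n) :
    ContDiff ℝ (⊤ : ℕ∞) (pd i f) := by
  unfold pd
  exact (hf.fderiv_right (m := (⊤ : ℕ∞)) (by simp)).clm_apply contDiff_const

lemma pd_comm {f : (Fin n → ℝ) → ℝ} (hf : ContDiff ℝ (⊤ : ℕ∞) f) (i j : Fin n) (x) :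
    pd i (pd j f) x = pd j (pd i f) x := by
  have hd : Differentiable ℝ (fderiv ℝ f) :=
    (hf.fderiv_right (m := (⊤ : ℕ∞)) (by simp)).differentiable top_ne
  have h : ∀ i j : Fin n, pd i (pd j f) x
      = fderiv ℝ (fderiv ℝ f) x (Pi.single i 1) (Pi.single j 1) := by
    intro i j
    unfold pd
    rw [fderiv_clm_apply (hd x) (differentiableAt_const _)]
    simp
  rw [h, h]
  have hs : IsSymmSndFDerivAt ℝ f x :=
    hf.contDiffAt.isSymmSndFDerivAt (by simp; exact WithTop.coe_le_coe.2 le_top)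
  exact hs _ _

lemma pder_add {A B : (Fin n → ℝ) → Matrix (Fin m) (Fin m) ℝ} (hA : SmoothMat A)
    (hB : SmoothMat B) (i : Fin n) (x) :
    pder i (fun y => A y + B y) x = pder i A x + pder i B x := by
  ext a b
  exact pd_add (hA a b) (hB a b) i x

lemma pder_sub {A B : (Fin n → ℝ) → Matrix (Fin m) (Fin m) ℝ} (hA : SmoothMat A)
    (hB : SmoothMat B) (i : Fin n) (x) :
    pder i (fun y => A y - B y) x = pder i A x - pder i B x := by
  ext a b
  exact pd_sub (hA a b) (hB a b) i x

lemma pder_smul {B : (Fin n → ℝ) → Matrix (Fin m) (Fin m) ℝ} (c : ℝ)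
    (hB : SmoothMat B) (i : Fin n) (x) :
    pder i (fun y => c • B y) x = c • pder i B x := by
  ext a b
  have := pd_mul (f := fun _ => c) contDiff_const (hB a b) i x
  rw [pd_const, zero_mul, zero_add] at this
  exact this

lemma pder_mul {A B : (Fin n → ℝ) → Matrix (Fin m) (Fin m) ℝ} (hA : SmoothMat A)
    (hB : SmoothMat B) (i : Fin n) (x) :
    pder i (fun y => A y * B y) x = pder i A x * B x + A x * pder i B x := by
  ext a b
  simp only [pder_apply, Matrix.mul_apply, Matrix.add_apply]
  rw [pd_sum _ fun k => (hA a k).mul (hB k b), ← Finset.sum_add_distrib]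
  exact Finset.sum_congr rfl fun k _ => pd_mul (hA a k) (hB k b) i x

lemma pder_pder_comm {A : (Fin n → ℝ) → Matrix (Fin m) (Fin m) ℝ} (hA : SmoothMat A)
    (i j : Fin n) (x) : pder i (fun y => pder j A y) x = pder j (fun y => pder i A y) x := by
  ext a b
  exact pd_comm (hA a b) i j x

lemma SmoothMat.add {A B : (Fin n → ℝ) → Matrix (Fin m) (Fin m) ℝ} (hA : SmoothMat A)
    (hB : SmoothMat B) : SmoothMat (fun y => A y + B y) := fun a b => (hA a b).add (hB a b)

lemma SmoothMat.sub {A B : (Fin n → ℝ) → Matrix (Fin m) (Fin m) ℝ} (hA : SmoothMat A)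
    (hB : SmoothMat B) : SmoothMat (fun y => A y - B y) := fun a b => (hA a b).sub (hB a b)

lemma SmoothMat.smul {A : (Fin n → ℝ) → Matrix (Fin m) (Fin m) ℝ} {f : (Fin n → ℝ) → ℝ}
    (hf : ContDiff ℝ (⊤ : ℕ∞) f) (hA : SmoothMat A) : SmoothMat (fun y => f y • A y) :=
  fun a b => hf.mul (hA a b)

lemma SmoothMat.sum {ι : Type*} (s : Finset ι) {A : ι → (Fin n → ℝ) → Matrix (Fin m) (Fin m) ℝ}
    (hA : ∀ i, SmoothMat (A i)) : SmoothMat (fun y => ∑ i ∈ s, A i y) := by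
  intro a b
  simp only [Matrix.sum_apply]
  exact ContDiff.sum fun i _ => hA i a b

lemma SmoothMat.mul {A B : (Fin n → ℝ) → Matrix (Fin m) (Fin m) ℝ} (hA : SmoothMat A)
    (hB : SmoothMat B) : SmoothMat (fun y => A y * B y) := by
  intro a b
  simp only [Matrix.mul_apply]
  exact ContDiff.sum fun k _ => (hA a k).mul (hB k b)

lemma SmoothMat.comm {A B : (Fin n → ℝ) → Matrix (Fin m) (Fin m) ℝ} (hA : SmoothMat A)
    (hB : SmoothMat B) : SmoothMat (fun y => comm (A y) (B y)) := (hA.mul hB).sub (hB.mul hA)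

lemma SmoothMat.pder {A : (Fin n → ℝ) → Matrix (Fin m) (Fin m) ℝ} (hA : SmoothMat A)
    (i : Fin n) : SmoothMat (fun y => pder i A y) := fun a b => pd_contDiff (hA a b) i

lemma Smooth.curv {Γ : Conn n m} (h : Smooth Γ) (i j : Fin n) :
    SmoothMat (fun y => curv Γ i j y) :=
  (((h j).pder i).sub ((h i).pder j)).add ((h i).comm (h j))

lemma SmoothMat.covDer {Γ : Conn n m} (h : Smooth Γ) {A : (Fin n → ℝ) → Matrix (Fin m) (Fin m) ℝ}
    (hA : SmoothMat A) (i : Fin n) : SmoothMat (fun y => covDer Γ i A y) :=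
  (hA.pder i).add ((h i).comm hA)

lemma pder_comm {A B : (Fin n → ℝ) → Matrix (Fin m) (Fin m) ℝ} (hA : SmoothMat A)
    (hB : SmoothMat B) (i : Fin n) (x) :
    pder i (fun y => comm (A y) (B y)) x = comm (pder i A x) (B x) + comm (A x) (pder i B x) := by
  unfold comm
  rw [pder_sub (hA.mul hB) (hB.mul hA), pder_mul hA hB, pder_mul hB hA]
  abel

lemma curv_antisymm (Γ : Conn n m) (i j : Fin n) (x) : curv Γ j i x = - curv Γ i j x := by
  unfold curv comm
  abel

lemma pder_curv {Γ : Conn n m} (h : Smooth Γ) (i j k : Fin n) (x) :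
    pder i (fun y => curv Γ j k y) x
      = pder i (fun y => pder j (fun z => Γ z k) y) x - pder i (fun y => pder k (fun z => Γ z j) y) x
        + (comm (pder i (fun y => Γ y j) x) (Γ x k) + comm (Γ x j) (pder i (fun y => Γ y k) x)) := by
  unfold curv
  rw [pder_add (((h k).pder j).sub ((h j).pder k)) ((h j).comm (h k)),
    pder_sub ((h k).pder j) ((h j).pder k), pder_comm (h j) (h k)]

lemma bianchi {Γ : Conn n m} (h : Smooth Γ) (i j k : Fin n) (x) :
    covDer Γ i (fun y => curv Γ j k y) x + covDer Γ j (fun y => curv Γ k i y) x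
      + covDer Γ k (fun y => curv Γ i j y) x = 0 := by
  unfold covDer
  rw [pder_curv h, pder_curv h, pder_curv h, pder_pder_comm (h k) i j, pder_pder_comm (h j) i k,
    pder_pder_comm (h i) j k]
  unfold curv comm
  noncomm_ring

/-! ### Frobenius inner product -/

lemma frobInner_comm (A B : Matrix (Fin m) (Fin m) ℝ) : frobInner A B = frobInner B A := by
  simp only [frobInner, mul_comm]

lemma frobInner_add_right (A B C : Matrix (Fin m) (Fin m) ℝ) :
    frobInner A (B + C) = frobInner A B + frobInner A C := by
  simp only [frobInner, Matrix.add_apply, mul_add, Finset.sum_add_distrib]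

lemma frobInner_smul_right (c : ℝ) (A B : Matrix (Fin m) (Fin m) ℝ) :
    frobInner A (c • B) = c * frobInner A B := by
  simp only [frobInner, Matrix.smul_apply, smul_eq_mul, Finset.mul_sum]
  refine Finset.sum_congr rfl fun a _ => Finset.sum_congr rfl fun b _ => by ring

lemma frobInner_neg_right (A B : Matrix (Fin m) (Fin m) ℝ) :
    frobInner A (-B) = - frobInner A B := by
  simpa using frobInner_smul_right (-1) A B

lemma frobInner_zero_right (A : Matrix (Fin m) (Fin m) ℝ) : frobInner A 0 = 0 := by
  simp [frobInner]

lemma frobInner_sub_right (A B C : Matrix (Fin m) (Fin m) ℝ) :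
    frobInner A (B - C) = frobInner A B - frobInner A C := by
  rw [sub_eq_add_neg, frobInner_add_right, frobInner_neg_right, sub_eq_add_neg]

lemma frobInner_sum_right {ι : Type*} (s : Finset ι) (A : Matrix (Fin m) (Fin m) ℝ)
    (B : ι → Matrix (Fin m) (Fin m) ℝ) :
    frobInner A (∑ i ∈ s, B i) = ∑ i ∈ s, frobInner A (B i) := by
  classical
  induction s using Finset.induction_on with
  | empty => simp [frobInner_zero_right]
  | insert a s ha ih => rw [Finset.sum_insert ha, Finset.sum_insert ha, frobInner_add_right, ih]

lemma frobInner_add_left (A B C : Matrix (Fin m) (Fin m) ℝ) :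
    frobInner (A + B) C = frobInner A C + frobInner B C := by
  rw [frobInner_comm, frobInner_add_right, frobInner_comm C, frobInner_comm C]

lemma frobInner_smul_left (c : ℝ) (A B : Matrix (Fin m) (Fin m) ℝ) :
    frobInner (c • A) B = c * frobInner A B := by
  rw [frobInner_comm, frobInner_smul_right, frobInner_comm]

lemma frobInner_neg_left (A B : Matrix (Fin m) (Fin m) ℝ) :
    frobInner (-A) B = - frobInner A B := by
  rw [frobInner_comm, frobInner_neg_right, frobInner_comm]

lemma frobInner_sub_left (A B C : Matrix (Fin m) (Fin m) ℝ) :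
    frobInner (A - B) C = frobInner A C - frobInner B C := by
  rw [frobInner_comm, frobInner_sub_right, frobInner_comm C, frobInner_comm C]

lemma frobInner_sum_left {ι : Type*} (s : Finset ι) (A : ι → Matrix (Fin m) (Fin m) ℝ)
    (B : Matrix (Fin m) (Fin m) ℝ) :
    frobInner (∑ i ∈ s, A i) B = ∑ i ∈ s, frobInner (A i) B := by
  rw [frobInner_comm, frobInner_sum_right]
  exact Finset.sum_congr rfl fun i _ => frobInner_comm _ _

lemma frobSq_eq (A : Matrix (Fin m) (Fin m) ℝ) : frobSq A = frobInner A A := by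
  simp only [frobSq, frobInner, pow_two]

lemma frobSq_nonneg (A : Matrix (Fin m) (Fin m) ℝ) : 0 ≤ frobSq A :=
  Finset.sum_nonneg fun a _ => Finset.sum_nonneg fun b _ => sq_nonneg _

lemma sq_le_frobSq (A : Matrix (Fin m) (Fin m) ℝ) (a b : Fin m) : A a b ^ 2 ≤ frobSq A :=
  (Finset.single_le_sum (f := fun b => A a b ^ 2) (fun b _ => sq_nonneg _) (Finset.mem_univ b)).trans
    (Finset.single_le_sum (f := fun a => ∑ b, A a b ^ 2)
      (fun a _ => Finset.sum_nonneg fun b _ => sq_nonneg _) (Finset.mem_univ a))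

lemma eq_zero_of_frobSq (A : Matrix (Fin m) (Fin m) ℝ) (h : frobSq A = 0) : A = 0 := by
  ext a b
  have := sq_le_frobSq A a b
  rw [h] at this
  simpa using pow_eq_zero_iff (two_ne_zero) |>.1 (le_antisymm this (sq_nonneg _))

lemma abs_le_frobNorm (A : Matrix (Fin m) (Fin m) ℝ) (a b : Fin m) : |A a b| ≤ frobNorm A :=
  Real.abs_le_sqrt (sq_le_frobSq A a b)

lemma frobInner_trace (A B : Matrix (Fin m) (Fin m) ℝ) : frobInner A B = (Aᵀ * B).trace := by
  simp only [frobInner, Matrix.trace, Matrix.diag, Matrix.mul_apply, Matrix.transpose_apply]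
  exact Finset.sum_comm

lemma frobInner_ad (C A B : Matrix (Fin m) (Fin m) ℝ) (hC : Cᵀ = -C) :
    frobInner (comm C A) B + frobInner A (comm C B) = 0 := by
  rw [frobInner_trace, frobInner_trace, ← Matrix.trace_add]
  have : (comm C A)ᵀ * B + Aᵀ * comm C B = C * (Aᵀ * B) - (Aᵀ * B) * C := by
    simp only [comm, Matrix.transpose_sub, Matrix.transpose_mul, hC]
    noncomm_ring
  rw [this, Matrix.trace_sub, Matrix.trace_mul_comm, sub_self]

lemma SmoothMat.frobInner {A B : (Fin n → ℝ) → Matrix (Fin m) (Fin m) ℝ} (hA : SmoothMat A)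
    (hB : SmoothMat B) : ContDiff ℝ (⊤ : ℕ∞) (fun y => frobInner (A y) (B y)) := by
  unfold YM.frobInner
  exact ContDiff.sum fun a _ => ContDiff.sum fun b _ => (hA a b).mul (hB a b)

lemma pd_frobInner {Γ : Conn n m} (hmc : MetricCompat Γ)
    {A B : (Fin n → ℝ) → Matrix (Fin m) (Fin m) ℝ} (hA : SmoothMat A)
    (hB : SmoothMat B) (i : Fin n) (x) :
    pd i (fun y => frobInner (A y) (B y)) x
      = frobInner (covDer Γ i A x) (B x) + frobInner (A x) (covDer Γ i B x) := by
  have h1 : pd i (fun y => frobInner (A y) (B y)) x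
      = frobInner (pder i A x) (B x) + frobInner (A x) (pder i B x) := by
    unfold frobInner
    rw [pd_sum _ fun a => ContDiff.sum fun b _ => (hA a b).mul (hB a b), ← Finset.sum_add_distrib]
    refine Finset.sum_congr rfl fun a _ => ?_
    rw [pd_sum _ fun b => (hA a b).mul (hB a b), ← Finset.sum_add_distrib]
    exact Finset.sum_congr rfl fun b _ => pd_mul (hA a b) (hB a b) i x
  rw [h1, covDer, covDer, frobInner_add_left, frobInner_add_right]
  linarith [frobInner_ad (Γ x i) (A x) (B x) (hmc x i)]

/-- Sub-Gaussian growth of a matrix-valued map. -/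
def GrM (A : (Fin n → ℝ) → Matrix (Fin m) (Fin m) ℝ) : Prop := ∀ a b, Gr (fun x => A x a b)

lemma GrM.frobInner {A B : (Fin n → ℝ) → Matrix (Fin m) (Fin m) ℝ} (hA : GrM A)
    (hB : GrM B) : Gr (fun y => frobInner (A y) (B y)) := by
  unfold YM.frobInner
  exact Gr.sum _ fun a => Gr.sum _ fun b => (hA a b).mul (hB a b)

lemma GrM.of_compact {A : (Fin n → ℝ) → Matrix (Fin m) (Fin m) ℝ} (hA : SmoothMat A)
    {K : Set (Fin n → ℝ)} (hK : IsCompact K) (h : ∀ x, x ∉ K → A x = 0) : GrM A := by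
  intro a b
  refine Gr.of_compact (hA a b).continuous (HasCompactSupport.intro hK fun x hx => ?_)
  simp [h x hx]

lemma GrM.curv {Γ : Conn n m} (hp : PolyCurvGrowth2 Γ) (i j : Fin n) :
    GrM (fun x => curv Γ i j x) := by
  obtain ⟨p, hp⟩ := hp
  intro a b
  refine (Gr.poly p).mono fun x => le_trans ?_ (hp x)
  have h1 : |YM.curv Γ i j x a b| ≤ normF Γ x := by
    refine Real.abs_le_sqrt ((sq_le_frobSq _ a b).trans ?_)
    exact (Finset.single_le_sum (f := fun j => frobSq (YM.curv Γ i j x))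
      (fun j _ => frobSq_nonneg _) (Finset.mem_univ j)).trans
      (Finset.single_le_sum (f := fun i => ∑ j, frobSq (YM.curv Γ i j x))
        (fun i _ => Finset.sum_nonneg fun j _ => frobSq_nonneg _) (Finset.mem_univ i))
  have h2 : 0 ≤ ∑ i, ∑ j, ∑ k, frobNorm (YM.covDer Γ i (fun y => YM.curv Γ j k y) x) :=
    Finset.sum_nonneg fun i _ => Finset.sum_nonneg fun j _ => Finset.sum_nonneg fun k _ =>
      Real.sqrt_nonneg _
  have h3 : 0 ≤ ∑ i, ∑ j, ∑ k, ∑ l,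
          frobNorm (YM.covDer Γ i
            (fun y => YM.covDer Γ j (fun z => YM.curv Γ k l z) y) x) :=
    Finset.sum_nonneg fun i _ => Finset.sum_nonneg fun j _ => Finset.sum_nonneg fun k _ =>
      Finset.sum_nonneg fun l _ => Real.sqrt_nonneg _
  linarith

lemma GrM.covDer_curv {Γ : Conn n m} (hp : PolyCurvGrowth2 Γ) (i j k : Fin n) :
    GrM (fun x => covDer Γ i (fun y => YM.curv Γ j k y) x) := by
  obtain ⟨p, hp⟩ := hp
  intro a b
  refine (Gr.poly p).mono fun x => le_trans ?_ (hp x)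
  have h1 : 0 ≤ normF Γ x := Real.sqrt_nonneg _
  have h2 : frobNorm (YM.covDer Γ i (fun y => YM.curv Γ j k y) x)
      ≤ ∑ i, ∑ j, ∑ k, frobNorm (YM.covDer Γ i (fun y => YM.curv Γ j k y) x) := by
    refine (Finset.single_le_sum
      (f := fun k => frobNorm (YM.covDer Γ i (fun y => YM.curv Γ j k y) x))
      (fun k _ => Real.sqrt_nonneg _) (Finset.mem_univ k)).trans ?_
    refine (Finset.single_le_sum
      (f := fun j => ∑ k, frobNorm (YM.covDer Γ i (fun y => YM.curv Γ j k y) x))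
      (fun j _ => Finset.sum_nonneg fun k _ => Real.sqrt_nonneg _) (Finset.mem_univ j)).trans ?_
    exact (Finset.single_le_sum
      (f := fun i => ∑ j, ∑ k, frobNorm (YM.covDer Γ i (fun y => YM.curv Γ j k y) x))
      (fun i _ => Finset.sum_nonneg fun j _ => Finset.sum_nonneg fun k _ => Real.sqrt_nonneg _)
      (Finset.mem_univ i))
  have h3 : 0 ≤ ∑ i, ∑ j, ∑ k, ∑ l,
          frobNorm (YM.covDer Γ i
            (fun y => YM.covDer Γ j (fun z => YM.curv Γ k l z) y) x) :=
    Finset.sum_nonneg fun i _ => Finset.sum_nonneg fun j _ => Finset.sum_nonneg fun k _ =>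
      Finset.sum_nonneg fun l _ => Real.sqrt_nonneg _
  have := abs_le_frobNorm (YM.covDer Γ i (fun y => YM.curv Γ j k y) x) a b
  linarith

end YM
namespace YM

variable {n m : ℕ}

/-- The soliton tensor. -/
def sol (Γ : Conn n m) (x₀ : Fin n → ℝ) (t : ℝ) (k : Fin n) (x : Fin n → ℝ) :
    Matrix (Fin m) (Fin m) ℝ :=
  ∑ i, covDer Γ i (fun y => curv Γ i k y) x - (1 / (2 * t)) • ∑ i, (x i - x₀ i) • curv Γ i k x

lemma sol_smooth {Γ : Conn n m} (h : Smooth Γ) (x₀ : Fin n → ℝ) (t : ℝ) (k : Fin n) :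
    SmoothMat (sol Γ x₀ t k) := by
  unfold sol
  refine SmoothMat.sub (SmoothMat.sum _ fun i => (h.curv i k).covDer h i)
    (SmoothMat.smul contDiff_const (SmoothMat.sum _ fun i => SmoothMat.smul ?_ (h.curv i k)))
  fun_prop

lemma pder_skew {A : (Fin n → ℝ) → Matrix (Fin m) (Fin m) ℝ} (hA : ∀ x, (A x)ᵀ = - A x)
    (i : Fin n) (x) : (pder i A x)ᵀ = - pder i A x := by
  ext a b
  have h : (fun y => A y b a) = fun y => - A y a b := by
    funext y
    have := congrFun (congrFun (hA y) a) b
    simpa using this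
  simp only [Matrix.transpose_apply, Matrix.neg_apply, pder_apply, h, pd]
  rw [fderiv_fun_neg]
  rfl

lemma comm_skew {A B : Matrix (Fin m) (Fin m) ℝ} (hA : Aᵀ = -A) (hB : Bᵀ = -B) :
    (comm A B)ᵀ = - comm A B := by
  simp only [comm, Matrix.transpose_sub, Matrix.transpose_mul, hA, hB]
  noncomm_ring

lemma curv_skew {Γ : Conn n m} (h : MetricCompat Γ) (i j : Fin n) (x) :
    (curv Γ i j x)ᵀ = - curv Γ i j x := by
  unfold curv
  rw [Matrix.transpose_add, Matrix.transpose_sub, pder_skew (fun x => h x j),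
    pder_skew (fun x => h x i), comm_skew (h x i) (h x j)]
  abel

lemma covDer_skew {Γ : Conn n m} (h : MetricCompat Γ)
    {A : (Fin n → ℝ) → Matrix (Fin m) (Fin m) ℝ} (hA : ∀ x, (A x)ᵀ = - A x) (i : Fin n) (x) :
    (covDer Γ i A x)ᵀ = - covDer Γ i A x := by
  unfold covDer
  rw [Matrix.transpose_add, pder_skew hA, comm_skew (h x i) (hA x)]
  abel

lemma sol_skew {Γ : Conn n m} (h : MetricCompat Γ) (x₀ : Fin n → ℝ) (t : ℝ) (k : Fin n) (x) :
    (sol Γ x₀ t k x)ᵀ = - sol Γ x₀ t k x := by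
  unfold sol
  simp only [Matrix.transpose_sub, Matrix.transpose_sum, Matrix.transpose_smul, curv_skew h,
    covDer_skew h (curv_skew h _ _), Finset.sum_neg_distrib, smul_neg]
  abel

lemma compact_zero (B : Conn n m) (x : Fin n → ℝ) (hx : x ∉ tsupport B) (k : Fin n) :
    B x k = 0 ∧ ∀ i, pder i (fun y => B y k) x = 0 := by
  rw [notMem_tsupport_iff_eventuallyEq] at hx
  refine ⟨by rw [hx.eq_of_nhds]; rfl, fun i => ?_⟩
  ext a b
  have h : (fun y => B y k a b) =ᶠ[nhds x] fun _ => (0 : ℝ) := by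
    filter_upwards [hx] with y hy
    rw [hy]; rfl
  simp only [pder_apply, pd]
  rw [h.fderiv_eq]
  simp

lemma covDer_zero (Γ B : Conn n m) (x : Fin n → ℝ) (hx : x ∉ tsupport B) (i k : Fin n) :
    covDer Γ i (fun y => B y k) x = 0 := by
  obtain ⟨h1, h2⟩ := compact_zero B x hx k
  simp [covDer, h2, h1, comm]

lemma Dop_zero (Γ B : Conn n m) (x : Fin n → ℝ) (hx : x ∉ tsupport B) (i k : Fin n) :
    Dop Γ B i k x = 0 := by
  simp [Dop, covDer_zero Γ B x hx]

lemma Dop_smooth {Γ B : Conn n m} (h : Smooth Γ) (hB : Smooth B) (i k : Fin n) :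
    SmoothMat (fun x => Dop Γ B i k x) :=
  ((hB k).covDer h i).sub ((hB i).covDer h k)

lemma curv_var {Γ B : Conn n m} (h : Smooth Γ) (hB : Smooth B) (s : ℝ) (i j : Fin n) (x) :
    curv (fun x i => Γ x i + s • B x i) i j x
      = curv Γ i j x + s • Dop Γ B i j x + s ^ 2 • comm (B x i) (B x j) := by
  have hs : ∀ k, SmoothMat (fun y => s • B y k) := fun k => SmoothMat.smul contDiff_const (hB k)
  unfold curv
  rw [pder_add (h j) (hs j), pder_add (h i) (hs i), pder_smul s (hB j), pder_smul s (hB i)]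
  unfold Dop covDer comm
  simp only [add_mul, mul_add, smul_mul_assoc, mul_smul_comm]
  module

/-- Zeroth coefficient. -/
def c0 (Γ : Conn n m) (x : Fin n → ℝ) : ℝ := ∑ i, ∑ j, frobInner (curv Γ i j x) (curv Γ i j x)
/-- First coefficient. -/
def c1 (Γ B : Conn n m) (x : Fin n → ℝ) : ℝ :=
  ∑ i, ∑ j, 2 * frobInner (curv Γ i j x) (Dop Γ B i j x)
/-- Second coefficient. -/
def c2 (Γ B : Conn n m) (x : Fin n → ℝ) : ℝ :=
  ∑ i, ∑ j, (2 * frobInner (curv Γ i j x) (comm (B x i) (B x j))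
    + frobInner (Dop Γ B i j x) (Dop Γ B i j x))
/-- Third coefficient. -/
def c3 (Γ B : Conn n m) (x : Fin n → ℝ) : ℝ :=
  ∑ i, ∑ j, 2 * frobInner (Dop Γ B i j x) (comm (B x i) (B x j))
/-- Fourth coefficient. -/
def c4 (B : Conn n m) (x : Fin n → ℝ) : ℝ :=
  ∑ i, ∑ j, frobInner (comm (B x i) (B x j)) (comm (B x i) (B x j))

lemma normSqF_var {Γ B : Conn n m} (h : Smooth Γ) (hB : Smooth B) (s : ℝ) (x) :
    normSqF (fun x i => Γ x i + s • B x i) x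
      = c0 Γ x + s * c1 Γ B x + s ^ 2 * c2 Γ B x + s ^ 3 * c3 Γ B x + s ^ 4 * c4 B x := by
  unfold normSqF c0 c1 c2 c3 c4
  simp only [Finset.mul_sum, ← Finset.sum_add_distrib]
  refine Finset.sum_congr rfl fun i _ => Finset.sum_congr rfl fun j _ => ?_
  rw [curv_var h hB, frobSq_eq]
  simp only [frobInner_add_left, frobInner_add_right, frobInner_smul_left, frobInner_smul_right]
  rw [frobInner_comm (Dop Γ B i j x) (curv Γ i j x),
    frobInner_comm (comm (B x i) (B x j)) (curv Γ i j x),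
    frobInner_comm (comm (B x i) (B x j)) (Dop Γ B i j x)]
  ring

lemma pref_hasDerivAt (n : ℕ) {t : ℝ} (ht : 0 < t) (τ : ℝ) :
    HasDerivAt (fun s : ℝ => (t + s * τ) ^ 2 * (4 * π * (t + s * τ)) ^ (-(n : ℝ) / 2))
      (t ^ 2 * (4 * π * t) ^ (-(n : ℝ) / 2) * (τ * (2 / t - n / (2 * t)))) 0 := by
  have h1 : HasDerivAt (fun s : ℝ => t + s * τ) τ 0 := by
    simpa using ((hasDerivAt_id (0 : ℝ)).mul_const τ).const_add t
  have hp : 0 < 4 * π * t := by positivity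
  have h2 := (h1.const_mul (4 * π)).rpow_const (p := -(n : ℝ) / 2)
    (Or.inl (by simpa using hp.ne'))
  have h3 := (h1.fun_pow 2).fun_mul h2
  refine h3.congr_deriv ?_
  simp only [zero_mul, add_zero]
  rw [rpow_sub_one hp.ne']
  field_simp
  push_cast
  ring

lemma integral_var {Γ B : Conn n m} (h : Smooth Γ) (hp : PolyCurvGrowth2 Γ) (hB : Smooth B)
    (hc : HasCompactSupport B) (x₀ v : Fin n → ℝ) {t : ℝ} (ht : 0 < t) (τ : ℝ) :
    HasDerivAt (fun s : ℝ => Ffunc (fun x i => Γ x i + s • B x i) (x₀ + s • v) (t + s * τ))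
      (t ^ 2 * (4 * π * t) ^ (-(n : ℝ) / 2) *
        ((τ * (2 / t - n / (2 * t))) * (∫ x, c0 Γ x * gw x₀ t x)
          + (∫ x, c0 Γ x * (gwE x₀ v t τ x * gw x₀ t x)) + ∫ x, c1 Γ B x * gw x₀ t x)) 0 := by
  have hF := fun i j => GrM.curv hp i j
  have hD : ∀ i j, GrM (fun x => Dop Γ B i j x) := fun i j =>
    GrM.of_compact (Dop_smooth h hB i j) hc.isCompact fun x hx => Dop_zero Γ B x hx i j
  have hC : ∀ i j, GrM (fun x => comm (B x i) (B x j)) := fun i j =>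
    GrM.of_compact ((hB i).comm (hB j)) hc.isCompact fun x hx => by
      simp [comm, (compact_zero B x hx i).1]
  have sF := fun i j => h.curv i j
  have sD := fun i j => Dop_smooth h hB i j
  have sC := fun i j => (hB i).comm (hB j)
  have g0 : Gr (c0 Γ) := Gr.sum _ fun i => Gr.sum _ fun j => (hF i j).frobInner (hF i j)
  have g1 : Gr (c1 Γ B) := Gr.sum _ fun i => Gr.sum _ fun j =>
    (Gr.const 2).mul ((hF i j).frobInner (hD i j))
  have g2 : Gr (c2 Γ B) := Gr.sum _ fun i => Gr.sum _ fun j =>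
    ((Gr.const 2).mul ((hF i j).frobInner (hC i j))).add ((hD i j).frobInner (hD i j))
  have g3 : Gr (c3 Γ B) := Gr.sum _ fun i => Gr.sum _ fun j =>
    (Gr.const 2).mul ((hD i j).frobInner (hC i j))
  have g4 : Gr (c4 B) := Gr.sum _ fun i => Gr.sum _ fun j => (hC i j).frobInner (hC i j)
  have k0 : Continuous (c0 Γ) := continuous_finsetSum _ fun i _ => continuous_finsetSum _ fun j _ =>
    ((sF i j).frobInner (sF i j)).continuous
  have k1 : Continuous (c1 Γ B) := continuous_finsetSum _ fun i _ => continuous_finsetSum _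
    fun j _ => continuous_const.mul ((sF i j).frobInner (sD i j)).continuous
  have k2 : Continuous (c2 Γ B) := continuous_finsetSum _ fun i _ => continuous_finsetSum _
    fun j _ => (continuous_const.mul ((sF i j).frobInner (sC i j)).continuous).add
      ((sD i j).frobInner (sD i j)).continuous
  have k3 : Continuous (c3 Γ B) := continuous_finsetSum _ fun i _ => continuous_finsetSum _
    fun j _ => continuous_const.mul ((sD i j).frobInner (sC i j)).continuous
  have k4 : Continuous (c4 B) := continuous_finsetSum _ fun i _ => continuous_finsetSum _ fun j _ =>
    ((sC i j).frobInner (sC i j)).continuous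
  have d0 := integral_hasDerivAt g0 k0 x₀ v ht τ
  have d1 := (hasDerivAt_id (0 : ℝ)).fun_mul (integral_hasDerivAt g1 k1 x₀ v ht τ)
  have d2 := (hasDerivAt_pow 2 (0 : ℝ)).fun_mul (integral_hasDerivAt g2 k2 x₀ v ht τ)
  have d3 := (hasDerivAt_pow 3 (0 : ℝ)).fun_mul (integral_hasDerivAt g3 k3 x₀ v ht τ)
  have d4 := (hasDerivAt_pow 4 (0 : ℝ)).fun_mul (integral_hasDerivAt g4 k4 x₀ v ht τ)
  have D := (pref_hasDerivAt n ht τ).fun_mul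
    ((((d0.fun_add d1).fun_add d2).fun_add d3).fun_add d4)
  have hev : ∀ᶠ s : ℝ in nhds 0, 0 < t + s * τ := by
    have : ContinuousAt (fun s : ℝ => t + s * τ) 0 := by fun_prop
    exact this.eventually (lt_mem_nhds (by simpa using ht))
  have D' := D.congr_of_eventuallyEq (f₁ := fun s : ℝ =>
    Ffunc (fun x i => Γ x i + s • B x i) (x₀ + s • v) (t + s * τ)) ?_
  · refine D'.congr_deriv ?_
    simp
    ring
  · filter_upwards [hev] with s hs
    have i0 := g0.integrable_gw k0 (x₀ + s • v) hs
    have i1 := (g1.integrable_gw k1 (x₀ + s • v) hs).const_mul s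
    have i2 := (g2.integrable_gw k2 (x₀ + s • v) hs).const_mul (s ^ 2)
    have i3 := (g3.integrable_gw k3 (x₀ + s • v) hs).const_mul (s ^ 3)
    have i4 := (g4.integrable_gw k4 (x₀ + s • v) hs).const_mul (s ^ 4)
    unfold Ffunc
    congr 1
    simp only [id]
    rw [← integral_const_mul, ← integral_const_mul, ← integral_const_mul, ← integral_const_mul,
      ← integral_add i0 i1, ← integral_add (i0.fun_add i1) i2, ← integral_add ((i0.fun_add i1).fun_add i2) i3,
      ← integral_add (((i0.fun_add i1).fun_add i2).fun_add i3) i4]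
    refine integral_congr_ae (ae_of_all _ fun x => ?_)
    simp only [normSqF_var h hB, Pi.add_apply]
    change _ * gw (x₀ + s • v) (t + s * τ) x = _
    ring

lemma first_var {Γ B : Conn n m} (h : Smooth Γ) (hmc : MetricCompat Γ) (hp : PolyCurvGrowth2 Γ)
    (hB : Smooth B) (hc : HasCompactSupport B) (x₀ : Fin n → ℝ) {t : ℝ} (ht : 0 < t) :
    ∫ x, c1 Γ B x * gw x₀ t x
      = -4 * ∫ x, (∑ k, frobInner (sol Γ x₀ t k x) (B x k)) * gw x₀ t x := by
  have hF := fun i j => GrM.curv hp i j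
  have hBG : ∀ j, GrM (fun x => B x j) := fun j =>
    GrM.of_compact (hB j) hc.isCompact fun x hx => (compact_zero B x hx j).1
  have hcG : ∀ i j, GrM (fun x => covDer Γ i (fun y => B y j) x) := fun i j =>
    GrM.of_compact ((hB j).covDer h i) hc.isCompact fun x hx => covDer_zero Γ B x hx i j
  have hD : ∀ i j, GrM (fun x => Dop Γ B i j x) := fun i j =>
    GrM.of_compact (Dop_smooth h hB i j) hc.isCompact fun x hx => Dop_zero Γ B x hx i j
  have g1 : Gr (c1 Γ B) := Gr.sum _ fun i => Gr.sum _ fun j =>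
    (Gr.const 2).mul ((hF i j).frobInner (hD i j))
  have k1 : Continuous (c1 Γ B) := continuous_finsetSum _ fun i _ => continuous_finsetSum _
    fun j _ => continuous_const.mul ((h.curv i j).frobInner (Dop_smooth h hB i j)).continuous
  set q : (Fin n → ℝ) → ℝ := fun x => ∑ k, frobInner (sol Γ x₀ t k x) (B x k) with hq
  have kq : Continuous q := continuous_finsetSum _ fun k _ =>
    ((sol_smooth h x₀ t k).frobInner (hB k)).continuous
  have gq : Gr q := Gr.of_compact kq (HasCompactSupport.intro hc.isCompact fun x hx =>
    Finset.sum_eq_zero fun k _ => by rw [(compact_zero B x hx k).1, frobInner_zero_right])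
  set P : Fin n → (Fin n → ℝ) → ℝ := fun i x => ∑ j, frobInner (curv Γ i j x) (B x j) with hP
  have hpd : ∀ i, pd i (P i) = fun x => ∑ j,
      (frobInner (covDer Γ i (fun y => curv Γ i j y) x) (B x j)
        + frobInner (curv Γ i j x) (covDer Γ i (fun y => B y j) x)) := by
    intro i
    funext x
    rw [hP]
    simp only
    rw [pd_sum _ fun j => (h.curv i j).frobInner (hB j)]
    exact Finset.sum_congr rfl fun j _ => pd_frobInner hmc (h.curv i j) (hB j) i x
  have key := div_zero' P (fun i => ContDiff.sum fun j _ => (h.curv i j).frobInner (hB j))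
    (fun i => Gr.sum _ fun j => (hF i j).frobInner (hBG j))
    (fun i => by
      rw [hpd i]
      exact Gr.sum _ fun j => ((GrM.covDer_curv hp i i j).frobInner (hBG j)).add
        ((hF i j).frobInner (hcG i j))) x₀ ht
  have hpt : ∀ x, (∑ i, (pd i (P i) x - (x i - x₀ i) / (2 * t) * P i x))
      = q x + (1 / 4) * c1 Γ B x := by
    intro x
    have e1 : q x = ∑ i, ∑ j, frobInner (covDer Γ i (fun y => curv Γ i j y) x) (B x j)
        - ∑ i, (x i - x₀ i) / (2 * t) * P i x := by
      simp only [hq, sol, hP, frobInner_sub_left, frobInner_sum_left, frobInner_smul_left,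
        Finset.sum_sub_distrib, Finset.mul_sum]
      rw [Finset.sum_comm]
      congr 1
      rw [Finset.sum_comm]
      refine Finset.sum_congr rfl fun i _ => Finset.sum_congr rfl fun j _ => by ring
    have e2 : c1 Γ B x = 4 * ∑ i, ∑ j, frobInner (curv Γ i j x) (covDer Γ i (fun y => B y j) x) := by
      have e3 : ∑ i, ∑ j, frobInner (curv Γ i j x) (covDer Γ j (fun y => B y i) x)
          = - ∑ i, ∑ j, frobInner (curv Γ i j x) (covDer Γ i (fun y => B y j) x) := by
        rw [Finset.sum_comm, ← Finset.sum_neg_distrib]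
        refine Finset.sum_congr rfl fun i _ => ?_
        rw [← Finset.sum_neg_distrib]
        refine Finset.sum_congr rfl fun j _ => ?_
        rw [curv_antisymm Γ i j x, frobInner_neg_left]
      simp only [c1, Dop, frobInner_sub_right, mul_sub, Finset.sum_sub_distrib, ← Finset.mul_sum]
      rw [e3]
      ring
    rw [e1, e2, Finset.sum_sub_distrib]
    simp only [hpd, Finset.sum_add_distrib]
    ring
  simp only [hpt, add_mul] at key
  rw [integral_add (gq.integrable_gw kq x₀ ht)
    (by simpa [mul_assoc] using (g1.integrable_gw k1 x₀ ht).const_mul (1 / 4))] at key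
  simp only [mul_assoc] at key
  rw [integral_const_mul] at key
  linarith

lemma covDer_curv_antisymm {Γ : Conn n m} (h : Smooth Γ) (i j k : Fin n) (x) :
    covDer Γ i (fun y => curv Γ k j y) x = - covDer Γ i (fun y => curv Γ j k y) x := by
  have e : (fun y => curv Γ k j y) = fun y => (-1 : ℝ) • curv Γ j k y := by
    funext y
    rw [curv_antisymm Γ j k y, neg_one_smul]
  rw [e]
  unfold covDer
  rw [pder_smul _ (h.curv j k)]
  simp [comm]
  abel

lemma bianchi_contr {Γ : Conn n m} (h : Smooth Γ) (j : Fin n) (x) :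
    ∑ i, ∑ k, frobInner (covDer Γ i (fun y => curv Γ j k y) x) (curv Γ i k x)
      = (∑ i, ∑ k, frobInner (covDer Γ j (fun y => curv Γ i k y) x) (curv Γ i k x)) / 2 := by
  have e1 : ∑ i, ∑ k, frobInner (covDer Γ i (fun y => curv Γ j k y) x) (curv Γ i k x)
      = ∑ i, ∑ k, frobInner (covDer Γ k (fun y => curv Γ i j y) x) (curv Γ i k x) := by
    rw [Finset.sum_comm]
    refine Finset.sum_congr rfl fun i _ => Finset.sum_congr rfl fun k _ => ?_
    rw [covDer_curv_antisymm h k i j, curv_antisymm Γ i k, frobInner_neg_left,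
      frobInner_neg_right, neg_neg]
  have e2 : ∑ i, ∑ k, (frobInner (covDer Γ i (fun y => curv Γ j k y) x) (curv Γ i k x)
      - frobInner (covDer Γ j (fun y => curv Γ i k y) x) (curv Γ i k x)
      + frobInner (covDer Γ k (fun y => curv Γ i j y) x) (curv Γ i k x)) = 0 := by
    refine Finset.sum_eq_zero fun i _ => Finset.sum_eq_zero fun k _ => ?_
    have hb := bianchi h i j k x
    rw [covDer_curv_antisymm h j i k, ← sub_eq_add_neg] at hb
    rw [← frobInner_sub_left, ← frobInner_add_left, hb, frobInner_comm, frobInner_zero_right]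
  simp only [Finset.sum_add_distrib, Finset.sum_sub_distrib] at e2
  linarith

lemma alg (M X Y : Fin n → Fin n → ℝ) (Z y v V : Fin n → ℝ) (f t τ : ℝ) (ht : 0 < t)
    (hf : ∑ i, M i i = f) (H1 : ∀ j, ∑ i, X i j = Z j / 2)
    (H2 : ∀ j, ∑ i, Y i j = ∑ i, y i / (2 * t) * M j i)
    (hV : ∀ i, V i = 2 * v i + τ / t * y i) :
    ∑ i, ((∑ j, ((if j = i then τ / t else 0) * M j i + V j * (X i j + Y i j))
      - 1 / 4 * (τ / t * f + V i * (2 * Z i))) - y i / (2 * t) * (∑ j, V j * M j i - 1 / 4 * (V i * f)))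
    = 1 / 2 * (f * (τ * (2 / t - n / (2 * t)) + ((∑ i, y i * v i) / (2 * t)
        + τ * (∑ i, y i ^ 2) / (4 * t ^ 2)))) := by
  have a1 : ∑ i, ∑ j, (if j = i then τ / t else 0) * M j i = τ / t * f := by
    simp [ite_mul, ← hf, Finset.mul_sum]
  have a2 : ∑ i, ∑ j, V j * X i j = ∑ j, V j * (Z j / 2) := by
    rw [Finset.sum_comm]
    exact Finset.sum_congr rfl fun j _ => by rw [← H1 j, Finset.mul_sum]
  have a3 : ∑ i, ∑ j, V j * Y i j = ∑ i, y i / (2 * t) * ∑ j, V j * M j i := by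
    rw [Finset.sum_comm]
    simp only [← Finset.mul_sum, H2]
    simp only [Finset.mul_sum]
    rw [Finset.sum_comm]
    refine Finset.sum_congr rfl fun i _ => Finset.sum_congr rfl fun j _ => by ring
  have a4 : ∑ i, y i / (2 * t) * (1 / 4 * (V i * f))
      = f / (8 * t) * (2 * ∑ i, y i * v i + τ / t * ∑ i, y i ^ 2) := by
    rw [Finset.mul_sum, Finset.mul_sum, ← Finset.sum_add_distrib, Finset.mul_sum]
    refine Finset.sum_congr rfl fun i _ => ?_
    rw [hV]
    field_simp
    ring
  have a5 : ∑ i, 1 / 4 * (τ / t * f + V i * (2 * Z i))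
      = n * (1 / 4 * (τ / t * f)) + ∑ j, V j * (Z j / 2) := by
    have e : ∀ i, 1 / 4 * (τ / t * f + V i * (2 * Z i))
        = 1 / 4 * (τ / t * f) + V i * (Z i / 2) := fun i => by ring
    simp only [e, Finset.sum_add_distrib, Finset.sum_const, Finset.card_univ,
      Fintype.card_fin, nsmul_eq_mul]
  simp only [Finset.sum_sub_distrib, mul_sub, Finset.sum_add_distrib, mul_add] at a5 ⊢
  rw [a1, a2, a3, a4]
  simp only [mul_add] at a4
  rw [a5]
  field_simp
  ring

lemma soliton_var {Γ : Conn n m} (h : Smooth Γ) (hmc : MetricCompat Γ) (hp : PolyCurvGrowth2 Γ)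
    (x₀ v : Fin n → ℝ) {t : ℝ} (ht : 0 < t) (τ : ℝ) (hs : IsSolitonAt Γ x₀ t) :
    (τ * (2 / t - n / (2 * t))) * (∫ x, c0 Γ x * gw x₀ t x)
      + (∫ x, c0 Γ x * (gwE x₀ v t τ x * gw x₀ t x)) = 0 := by
  have hF := fun i j => GrM.curv hp i j
  have g0 : Gr (c0 Γ) := Gr.sum _ fun i => Gr.sum _ fun j => (hF i j).frobInner (hF i j)
  have s0 : ContDiff ℝ (⊤ : ℕ∞) (c0 Γ) := ContDiff.sum fun i _ => ContDiff.sum fun j _ =>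
    (h.curv i j).frobInner (h.curv i j)
  set V : Fin n → (Fin n → ℝ) → ℝ := fun i x => 2 * v i + τ / t * (x i - x₀ i) with hV
  have sV : ∀ i, ContDiff ℝ (⊤ : ℕ∞) (V i) := fun i => by rw [hV]; fun_prop
  have gV : ∀ i, Gr (V i) := fun i =>
    (Gr.const _).add ((Gr.const _).mul ((Gr.coord i).sub (Gr.const _)))
  have pV : ∀ i j x, pd i (V j) x = if j = i then τ / t else 0 := by
    intro i j x
    have e1 := pd_add (f := fun _ => 2 * v j) (g := fun x => τ / t * (x j - x₀ j)) contDiff_const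
      (by fun_prop) i x
    have e2 := pd_mul (f := fun _ => τ / t) (g := fun x => x j - x₀ j) contDiff_const
      (by fun_prop) i x
    have e3 := pd_sub (f := fun x : Fin n → ℝ => x j) (g := fun _ => x₀ j) (by fun_prop)
      contDiff_const i x
    rw [pd_const] at e1 e2 e3
    rw [pd_coord] at e3
    rw [hV]
    simp only
    rw [e1, e2, e3]
    split_ifs <;> simp
  set M : Fin n → Fin n → (Fin n → ℝ) → ℝ := fun j i x =>
    ∑ k, frobInner (curv Γ j k x) (curv Γ i k x) with hM
  have sM : ∀ j i, ContDiff ℝ (⊤ : ℕ∞) (M j i) := fun j i => ContDiff.sum fun k _ =>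
    (h.curv j k).frobInner (h.curv i k)
  have gM : ∀ j i, Gr (M j i) := fun j i => Gr.sum _ fun k => (hF j k).frobInner (hF i k)
  set X : Fin n → Fin n → (Fin n → ℝ) → ℝ := fun i j x =>
    ∑ k, frobInner (covDer Γ i (fun y => curv Γ j k y) x) (curv Γ i k x) with hX
  set Y : Fin n → Fin n → (Fin n → ℝ) → ℝ := fun i j x =>
    ∑ k, frobInner (curv Γ j k x) (covDer Γ i (fun y => curv Γ i k y) x) with hY
  set Z : Fin n → (Fin n → ℝ) → ℝ := fun i x =>
    ∑ j, ∑ k, frobInner (covDer Γ i (fun y => curv Γ j k y) x) (curv Γ j k x) with hZ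
  have gX : ∀ i j, Gr (X i j) := fun i j => Gr.sum _ fun k =>
    (GrM.covDer_curv hp i j k).frobInner (hF i k)
  have gY : ∀ i j, Gr (Y i j) := fun i j => Gr.sum _ fun k =>
    (hF j k).frobInner (GrM.covDer_curv hp i i k)
  have gZ : ∀ i, Gr (Z i) := fun i => Gr.sum _ fun j => Gr.sum _ fun k =>
    (GrM.covDer_curv hp i j k).frobInner (hF j k)
  have pM : ∀ i j x, pd i (M j i) x = X i j x + Y i j x := by
    intro i j x
    rw [hM, hX, hY]
    simp only
    rw [pd_sum _ fun k => (h.curv j k).frobInner (h.curv i k), ← Finset.sum_add_distrib]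
    exact Finset.sum_congr rfl fun k _ => pd_frobInner hmc (h.curv j k) (h.curv i k) i x
  have p0 : ∀ i x, pd i (c0 Γ) x = 2 * Z i x := by
    intro i x
    rw [hZ]
    unfold c0
    simp only [Finset.mul_sum]
    rw [pd_sum _ fun j => ContDiff.sum fun k _ => (h.curv j k).frobInner (h.curv j k)]
    refine Finset.sum_congr rfl fun j _ => ?_
    rw [pd_sum _ fun k => (h.curv j k).frobInner (h.curv j k)]
    refine Finset.sum_congr rfl fun k _ => ?_
    rw [pd_frobInner hmc (h.curv j k) (h.curv j k) i x,
      frobInner_comm (curv Γ j k x)]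
    ring
  set P : Fin n → (Fin n → ℝ) → ℝ := fun i x =>
    ∑ j, V j x * M j i x - 1 / 4 * (V i x * c0 Γ x) with hP
  have hpd : ∀ i, pd i (P i) = fun x =>
      ∑ j, ((if j = i then τ / t else 0) * M j i x + V j x * (X i j x + Y i j x))
      - 1 / 4 * (τ / t * c0 Γ x + V i x * (2 * Z i x)) := by
    intro i
    funext x
    rw [hP]
    simp only
    rw [pd_sub (ContDiff.sum fun j _ => (sV j).mul (sM j i))
      (contDiff_const.mul ((sV i).mul s0)), pd_sum _ fun j => (sV j).mul (sM j i),
      pd_mul contDiff_const ((sV i).mul s0), pd_const, pd_mul (sV i) s0, pV, p0]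
    simp only [if_true, zero_mul, zero_add]
    congr 1
    refine Finset.sum_congr rfl fun j _ => ?_
    rw [pd_mul (sV j) (sM j i), pV, pM]
  have key := div_zero' P (fun i => (ContDiff.sum fun j _ => (sV j).mul (sM j i)).sub
      (contDiff_const.mul ((sV i).mul s0)))
    (fun i => (Gr.sum _ fun j => (gV j).mul (gM j i)).sub ((Gr.const _).mul ((gV i).mul g0)))
    (fun i => by
      rw [hpd i]
      exact (Gr.sum _ fun j => ((Gr.const _).mul (gM j i)).add
        ((gV j).mul ((gX i j).add (gY i j)))).sub
        ((Gr.const _).mul (((Gr.const _).mul g0).add ((gV i).mul ((Gr.const _).mul (gZ i))))))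
    x₀ ht
  have hpt : ∀ x, (∑ i, (pd i (P i) x - (x i - x₀ i) / (2 * t) * P i x))
      = 1 / 2 * (c0 Γ x * (τ * (2 / t - n / (2 * t)) + gwE x₀ v t τ x)) := by
    intro x
    simp only [hpd]
    refine alg (fun j i => M j i x) (fun i j => X i j x) (fun i j => Y i j x) (fun i => Z i x)
      (fun i => x i - x₀ i) v (fun i => V i x) (c0 Γ x) t τ ht rfl
      (fun j => bianchi_contr h j x) ?_ (fun i => rfl)
    intro j
    simp only [hY, hM]
    rw [Finset.sum_comm]
    simp only [← frobInner_sum_right]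
    simp only [hs x, frobInner_smul_right, frobInner_sum_right, Finset.mul_sum]
    rw [Finset.sum_comm]
    refine Finset.sum_congr rfl fun i _ => Finset.sum_congr rfl fun j _ => by ring
  simp only [hpt] at key
  have gE : Gr (gwE x₀ v t τ) := by
    have h1 : Gr (fun x : Fin n → ℝ => (∑ i, (x i - x₀ i) * v i) * (2 * t)⁻¹) :=
      (Gr.sum _ fun i => ((Gr.coord i).sub (Gr.const _)).mul (Gr.const _)).mul (Gr.const _)
    have h2 : Gr (fun x : Fin n → ℝ => (τ * ∑ i, (x i - x₀ i) ^ 2) * (4 * t ^ 2)⁻¹) :=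
      ((Gr.const _).mul (Gr.sum _ fun i => ((Gr.coord i).sub (Gr.const _)).pow 2)).mul (Gr.const _)
    exact h1.add h2
  have kE : Continuous (gwE x₀ v t τ) := by unfold gwE; fun_prop
  have i1 := (g0.integrable_gw s0.continuous x₀ ht).const_mul (τ * (2 / t - n / (2 * t)))
  have i2 := (g0.mul gE).integrable_gw (s0.continuous.mul kE) x₀ ht
  simp only [mul_assoc (c0 Γ _)] at i2
  rw [← integral_const_mul, ← integral_add i1 i2]
  have : ∀ x, τ * (2 / t - n / (2 * t)) * (c0 Γ x * gw x₀ t x)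
      + c0 Γ x * (gwE x₀ v t τ x * gw x₀ t x)
      = 2 * (1 / 2 * (c0 Γ x * (τ * (2 / t - n / (2 * t)) + gwE x₀ v t τ x)) * gw x₀ t x) := by
    intro x; ring
  simp only [this]
  rw [integral_const_mul, key, mul_zero]

end YM

/-- **Critical points of the `ℱ`-functional** (Corollary `Fcrit`):
`(Γ, x₀, t₀)` is a critical point of the `ℱ`-functional iff `Γ` is an
`(x₀,t₀)`-soliton. -/
theorem Fcritical_iff_soliton (n m : ℕ) (Γ : YM.Conn n m)
    (hsm : YM.Smooth Γ) (hmc : YM.MetricCompat Γ)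
    (hpoly : YM.PolyCurvGrowth2 Γ)
    (x₀ : Fin n → ℝ) (t₀ : ℝ) (ht₀ : 0 < t₀) :
    (∀ B : YM.Conn n m, YM.Smooth B → HasCompactSupport B → YM.SkewVals B →
        ∀ (v : Fin n → ℝ) (τ : ℝ),
          HasDerivAt (fun s : ℝ =>
              YM.Ffunc (fun x i => Γ x i + s • B x i) (x₀ + s • v) (t₀ + s * τ))
            0 0) ↔
      YM.IsSolitonAt Γ x₀ t₀ := by
  constructor
  · intro H x k
    let η : ContDiffBump x := ⟨1, 2, one_pos, one_lt_two⟩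
    set B : YM.Conn n m := fun y k => η y • YM.sol Γ x₀ t₀ k y with hBdef
    have hB : YM.Smooth B := fun k => YM.SmoothMat.smul η.contDiff (YM.sol_smooth hsm x₀ t₀ k)
    have hz : ∀ y, y ∉ tsupport η → η y = 0 := fun y hy => image_eq_zero_of_notMem_tsupport hy
    have hc : HasCompactSupport B := HasCompactSupport.intro η.hasCompactSupport.isCompact
      fun y hy => by
        funext k
        simp [hBdef, hz y hy]
    have hsk : YM.SkewVals B := fun y k => by
      simp only [hBdef, Matrix.transpose_smul, YM.sol_skew hmc, smul_neg]
    have h1 := H B hB hc hsk 0 0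
    have h2 := YM.integral_var hsm hpoly hB hc x₀ 0 ht₀ 0
    have h3 := h2.unique h1
    rw [YM.first_var hsm hmc hpoly hB hc x₀ ht₀] at h3
    have hC : t₀ ^ 2 * (4 * π * t₀) ^ (-(n : ℝ) / 2) ≠ 0 := by positivity
    have h4 : ∫ y, (∑ k, YM.frobInner (YM.sol Γ x₀ t₀ k y) (B y k)) * YM.gw x₀ t₀ y = 0 := by
      have := (mul_eq_zero.1 h3).resolve_left hC
      simpa [YM.gwE] using this
    set q : (Fin n → ℝ) → ℝ := fun y =>
      (∑ k, YM.frobInner (YM.sol Γ x₀ t₀ k y) (B y k)) * YM.gw x₀ t₀ y with hq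
    have hqe : ∀ y, q y = η y * (∑ k, YM.frobSq (YM.sol Γ x₀ t₀ k y)) * YM.gw x₀ t₀ y := by
      intro y
      simp only [hq, hBdef, YM.frobInner_smul_right, ← Finset.mul_sum, YM.frobSq_eq]
    have hS : ∀ y, 0 ≤ ∑ k, YM.frobSq (YM.sol Γ x₀ t₀ k y) := fun y =>
      Finset.sum_nonneg fun k _ => YM.frobSq_nonneg _
    have hqc : Continuous q := (continuous_finsetSum _ fun k _ =>
      ((YM.sol_smooth hsm x₀ t₀ k).frobInner (hB k)).continuous).mul
        (YM.gw_contDiff x₀ t₀).continuous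
    have hqs : HasCompactSupport q := HasCompactSupport.intro η.hasCompactSupport.isCompact
      fun y hy => by rw [hqe, hz y hy]; ring
    have hq0 : ∀ y, 0 ≤ q y := fun y => by
      rw [hqe]
      exact mul_nonneg (mul_nonneg η.nonneg (hS y)) (YM.gw_pos _ _ _).le
    have hqx : q x = 0 := by
      by_contra hne
      exact (hqc.integral_pos_of_hasCompactSupport_nonneg_nonzero (μ := volume) hqs hq0 hne).ne' h4
    have hη : η x = 1 := η.one_of_mem_closedBall (Metric.mem_closedBall_self η.rIn_pos.le)
    rw [hqe, hη, one_mul] at hqx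
    have h5 := (mul_eq_zero.1 hqx).resolve_right (YM.gw_pos _ _ _).ne'
    have h6 := (Finset.sum_eq_zero_iff_of_nonneg fun k _ => YM.frobSq_nonneg _).1 h5 k
      (Finset.mem_univ k)
    exact sub_eq_zero.1 (YM.eq_zero_of_frobSq _ h6)
  · intro hs B hB hc _ v τ
    have h2 := YM.integral_var hsm hpoly hB hc x₀ v ht₀ τ
    have hsol : ∀ k y, YM.sol Γ x₀ t₀ k y = 0 := fun k y => sub_eq_zero.2 (hs y k)
    rw [YM.first_var hsm hmc hpoly hB hc x₀ ht₀,
      YM.soliton_var hsm hmc hpoly x₀ v ht₀ τ hs] at h2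
    simpa [hsol, YM.frobInner] using h2
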